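/- arXiv:1401.6268 — 3 statements merged into one kernel-verified Lean document; each statement's English description precedes it below -/
import Mathlib

section
/- The intersection ⋂_{k ≥ 1} J^k of all powers of the ideal J equals the zero ideal of 𝔛_ℚ(H). -/
set_option synthInstance.maxHeartbeats 1000000
set_option maxHeartbeats 1000000

noncomputable section

abbrev SL2 : Type := Matrix.SpecialLinearGroup (Fin 2) ℂ

/-- The free abelian group of rank `n`, written multiplicatively. -/
abbrev H (n : ℕ) : Type := Multiplicative (Fin n → ℤ)

/-- The algebra of complex-valued functions on the representation space `R(H)`. -/
abbrev FR (n : ℕ) : Type := (H n →* SL2) → ℂ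

/-- The standard basis element `x_i` of `H`. -/
def xgen (n : ℕ) (i : Fin n) : H n := Multiplicative.ofAdd (Pi.single i 1)

/-- The Fricke character `tr x`. -/
def trc {n : ℕ} (x : H n) : FR n :=
  fun ρ => Matrix.trace ((ρ x : Matrix (Fin 2) (Fin 2) ℂ))

/-- The ring of Fricke characters `𝔛_ℚ(H)`. -/
def Xring (n : ℕ) : Subalgebra ℚ (FR n) :=
  Algebra.adjoin ℚ {f : FR n | ∃ x : H n, f = trc x}

/-- The ideal `J` generated by all `tr' x = tr x - 2`. -/
def Jideal (n : ℕ) : Ideal (Xring n) :=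
  Ideal.span {f : Xring n | ∃ x : H n, (f : FR n) = trc x - 2}

/-- `tr' x = tr x - 2` as an element of `𝔛_ℚ(H)`. -/
def trc' {n : ℕ} (x : H n) : Xring n :=
  ⟨trc x - 2, sub_mem (Algebra.subset_adjoin ⟨x, rfl⟩) (ofNat_mem _ 2)⟩

open Matrix

/-- A matrix commuting with a non-scalar `2 × 2` matrix `N` preserves the eigenlines of `N`. -/
lemma exists_mulVec_eq_smul_of_commute {K : Type*} [Field K] {M N : Matrix (Fin 2) (Fin 2) K}
    (hMN : M * N = N * M) {μ : K} (hN : N ≠ scalar (Fin 2) μ) {v : Fin 2 → K} (hv : v ≠ 0)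
    (hNv : N *ᵥ v = μ • v) : ∃ c : K, M *ᵥ v = c • v := by
  obtain ⟨w, hw⟩ : ∃ w, w = M *ᵥ v := ⟨_, rfl⟩
  have hNw : N *ᵥ w = μ • w := by
    rw [hw, mulVec_mulVec, ← hMN, ← mulVec_mulVec, hNv, mulVec_smul]
  rw [← hw]
  by_cases hd : v 0 * w 1 - v 1 * w 0 = 0
  · by_cases h0 : v 0 = 0
    · have h1 : v 1 ≠ 0 := fun h1 => hv (by ext i; fin_cases i <;> assumption)
      have hw0 : w 0 = 0 := by
        have : v 1 * w 0 = 0 := by linear_combination w 1 * h0 - hd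
        exact (mul_eq_zero.1 this).resolve_left h1
      refine ⟨w 1 / v 1, ?_⟩
      ext i
      fin_cases i
      · simp [h0, hw0]
      · simp [h1]
    · refine ⟨w 0 / v 0, ?_⟩
      ext i
      fin_cases i
      · simp [h0]
      · simp only [Fin.mk_one, Pi.smul_apply, smul_eq_mul]
        field_simp
        linear_combination hd
  · refine absurd ?_ hN
    have key : ∀ i, N i 0 * v 0 + N i 1 * v 1 = μ * v i ∧
        N i 0 * w 0 + N i 1 * w 1 = μ * w i := fun i => by
      have h1 := congrFun hNv i
      have h2 := congrFun hNw i
      simpa [mulVec, dotProduct, Fin.sum_univ_two] using And.intro h1 h2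
    ext i j
    refine sub_eq_zero.1 ((mul_eq_zero.1 ?_).resolve_right hd)
    obtain ⟨h1, h2⟩ := key i
    fin_cases i <;> fin_cases j <;>
      simp only [Fin.zero_eta, Fin.mk_one, scalar_apply, diagonal_apply, if_true, Fin.isValue,
        zero_ne_one, one_ne_zero, if_false] at h1 h2 ⊢
    · linear_combination w 1 * h1 - v 1 * h2
    · linear_combination v 0 * h2 - w 0 * h1
    · linear_combination w 1 * h1 - v 1 * h2
    · linear_combination v 0 * h2 - w 0 * h1

lemma coe_map_mul {G : Type*} [Group G] (ρ : G →* SL2) (x y : G) :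
    (ρ (x * y) : Matrix (Fin 2) (Fin 2) ℂ) = (ρ x : Matrix (Fin 2) (Fin 2) ℂ) * ρ y :=
  congrArg Subtype.val (map_mul ρ x y)

lemma coe_map_one {G : Type*} [Group G] (ρ : G →* SL2) :
    (ρ 1 : Matrix (Fin 2) (Fin 2) ℂ) = 1 :=
  congrArg Subtype.val (map_one ρ)

/-- A commutative group of `2 × 2` matrices over `ℂ` has a common eigenvector. -/
lemma exists_common_eigenvector {G : Type*} [CommGroup G] (ρ : G →* SL2) :
    ∃ v : Fin 2 → ℂ, v ≠ 0 ∧ ∀ x, ∃ c : ℂ, (ρ x : Matrix (Fin 2) (Fin 2) ℂ) *ᵥ v = c • v := by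
  by_cases h : ∀ x, ∃ c : ℂ, (ρ x : Matrix (Fin 2) (Fin 2) ℂ) = scalar (Fin 2) c
  · refine ⟨1, one_ne_zero, fun x => ?_⟩
    obtain ⟨c, hc⟩ := h x
    refine ⟨c, ?_⟩
    rw [hc]
    ext i
    simp [scalar_apply, mulVec_diagonal]
  · push Not at h
    obtain ⟨y, hy⟩ := h
    obtain ⟨μ, hμ⟩ := Module.End.exists_eigenvalue
      (toLin' (ρ y : Matrix (Fin 2) (Fin 2) ℂ))
    obtain ⟨v, hv⟩ := hμ.exists_hasEigenvector
    refine ⟨v, hv.2, fun x => exists_mulVec_eq_smul_of_commute ?_ (hy μ) hv.2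
      (by simpa using hv.apply_eq_smul)⟩
    rw [← coe_map_mul, ← coe_map_mul, mul_comm]

lemma SL2.ne_zero_of_mulVec_eq_smul {M : SL2} {v : Fin 2 → ℂ} (hv : v ≠ 0) {c : ℂ}
    (h : (M : Matrix (Fin 2) (Fin 2) ℂ) *ᵥ v = c • v) : c ≠ 0 := by
  rintro rfl
  rw [zero_smul] at h
  have := exists_mulVec_eq_zero_iff.1 ⟨v, hv, h⟩
  rw [M.det_coe] at this
  exact one_ne_zero this

lemma SL2.trace_eq_of_mulVec_eq_smul {M : SL2} {v : Fin 2 → ℂ} (hv : v ≠ 0) {c : ℂ}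
    (h : (M : Matrix (Fin 2) (Fin 2) ℂ) *ᵥ v = c • v) :
    trace (M : Matrix (Fin 2) (Fin 2) ℂ) = c + c⁻¹ := by
  have hc := ne_zero_of_mulVec_eq_smul hv h
  have hdet := exists_mulVec_eq_zero_iff.1
    ⟨v, hv, show ((M : Matrix (Fin 2) (Fin 2) ℂ) - scalar (Fin 2) c) *ᵥ v = 0 by
      rw [sub_mulVec, h]; ext i; simp [scalar_apply]⟩
  have hM := M.det_coe
  rw [det_fin_two] at hdet hM
  simp [scalar_apply] at hdet
  rw [trace_fin_two]
  field_simp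
  linear_combination hM - hdet

/-- The additive character of `ℤⁿ` with values `a i` on the standard basis. -/
def linForm {n : ℕ} (a : Fin n → ℂ) (x : Fin n → ℤ) : ℂ := ∑ i, a i * x i

lemma linForm_add {n : ℕ} (a : Fin n → ℂ) (x y : Fin n → ℤ) :
    linForm a (x + y) = linForm a x + linForm a y := by
  simp [linForm, mul_add, Finset.sum_add_distrib]

lemma linForm_neg {n : ℕ} (a : Fin n → ℂ) (x : Fin n → ℤ) :
    linForm a (-x) = -linForm a x := by
  simp [linForm]

lemma linForm_zero {n : ℕ} (a : Fin n → ℂ) : linForm a 0 = 0 := by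
  simp [linForm]

lemma linForm_single {n : ℕ} (a : Fin n → ℂ) (i : Fin n) :
    linForm a (Pi.single i 1) = a i := by
  simp [linForm, Pi.single_apply]

/-- The traces of a representation of `ℤⁿ` are those of a diagonal one. -/
lemma exists_trc_eq {n : ℕ} (ρ : H n →* SL2) :
    ∃ a : Fin n → ℂ, ∀ x : H n,
      trc x ρ = Complex.exp (linForm a x.toAdd) + Complex.exp (-linForm a x.toAdd) := by
  obtain ⟨v, hv, h⟩ := exists_common_eigenvector ρ
  have hlog : ∀ i, ∃ b : ℂ,
      (ρ (xgen n i) : Matrix (Fin 2) (Fin 2) ℂ) *ᵥ v = Complex.exp b • v := fun i => by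
    obtain ⟨c, hc⟩ := h (xgen n i)
    exact ⟨Complex.log c, by rw [Complex.exp_log (SL2.ne_zero_of_mulVec_eq_smul hv hc), hc]⟩
  choose a ha using hlog
  let S : AddSubgroup (Fin n → ℤ) :=
    { carrier := {x | (ρ (Multiplicative.ofAdd x) : Matrix (Fin 2) (Fin 2) ℂ) *ᵥ v =
        Complex.exp (linForm a x) • v}
      zero_mem' := by
        simp only [Set.mem_ofPred_eq]
        rw [ofAdd_zero, coe_map_one, one_mulVec, linForm_zero, Complex.exp_zero, one_smul]
      add_mem' := fun {x y} hx hy => by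
        simp only [Set.mem_ofPred_eq] at hx hy ⊢
        rw [ofAdd_add, coe_map_mul, ← mulVec_mulVec, hy, mulVec_smul, hx,
          smul_smul, linForm_add, Complex.exp_add, mul_comm]
      neg_mem' := fun {x} hx => by
        simp only [Set.mem_ofPred_eq] at hx ⊢
        have h1 : (ρ (Multiplicative.ofAdd (-x)) : Matrix (Fin 2) (Fin 2) ℂ) *ᵥ
            ((ρ (Multiplicative.ofAdd x) : Matrix (Fin 2) (Fin 2) ℂ) *ᵥ v) = v := by
          rw [mulVec_mulVec, ← coe_map_mul, ← ofAdd_add, neg_add_cancel, ofAdd_zero, coe_map_one,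
            one_mulVec]
        rw [hx, mulVec_smul] at h1
        rw [linForm_neg, Complex.exp_neg, eq_inv_smul_iff₀ (Complex.exp_ne_zero _), h1] }
  have hS : ∀ x, x ∈ S := fun x => by
    have hx : x = ∑ i, x i • (Pi.single i 1 : Fin n → ℤ) := by
      ext j
      simp [Finset.sum_apply, Pi.single_apply]
    rw [hx]
    refine sum_mem fun i _ => zsmul_mem ?_ _
    change _ = _
    rw [linForm_single]
    exact ha i
  refine ⟨a, fun x => ?_⟩
  rw [Complex.exp_neg]
  exact SL2.trace_eq_of_mulVec_eq_smul hv (hS x.toAdd)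

/-- The representation `x ↦ diag (exp (a x), exp (-a x))`. -/
def diagRep {n : ℕ} (a : Fin n → ℂ) : H n →* SL2 where
  toFun x := ⟨diagonal ![Complex.exp (linForm a x.toAdd), Complex.exp (-linForm a x.toAdd)], by
    simp [← Complex.exp_add]⟩
  map_one' := by
    ext i j
    fin_cases i <;> fin_cases j <;> simp [linForm_zero]
  map_mul' x y := by
    refine Subtype.ext (Eq.trans ?_ (diagonal_mul_diagonal _ _).symm)
    ext i j
    fin_cases i <;> fin_cases j <;> simp [linForm_add, Complex.exp_add, mul_comm]

lemma trc_diagRep {n : ℕ} (a : Fin n → ℂ) (x : H n) :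
    trc x (diagRep a) =
      Complex.exp (linForm a x.toAdd) + Complex.exp (-linForm a x.toAdd) := by
  change trace (diagonal _) = _
  simp [trace_diagonal]

lemma linForm_smul {n : ℕ} (t : ℂ) (a : Fin n → ℂ) (x : Fin n → ℤ) :
    linForm (t • a) x = t * linForm a x := by
  simp [linForm, Finset.mul_sum, mul_assoc]

/-- The value of an element of `𝔛_ℚ(H)` at a representation only depends on its traces. -/
lemma Xring_apply_eq {n : ℕ} {ρ σ : H n →* SL2} (h : ∀ x, trc x ρ = trc x σ) {f : FR n}
    (hf : f ∈ Xring n) : f ρ = f σ := by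
  induction hf using Algebra.adjoin_induction with
  | mem f hf => obtain ⟨x, rfl⟩ := hf; exact h x
  | algebraMap r => rfl
  | add f g _ _ hf hg => simp [hf, hg]
  | mul f g _ _ hf hg => simp [hf, hg]

lemma differentiable_Xring {n : ℕ} (a : Fin n → ℂ) {f : FR n} (hf : f ∈ Xring n) :
    Differentiable ℂ fun t : ℂ => f (diagRep (t • a)) := by
  induction hf using Algebra.adjoin_induction with
  | mem f hf =>
    obtain ⟨x, rfl⟩ := hf
    simp only [trc_diagRep, linForm_smul]
    fun_prop
  | algebraMap r => exact differentiable_const _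
  | add f g _ _ hf hg => exact hf.add hg
  | mul f g _ _ hf hg => exact hf.mul hg

lemma Jideal_apply_zero {n : ℕ} {f : Xring n} (hf : f ∈ Jideal n) (a : Fin n → ℂ) :
    (f : FR n) (diagRep ((0 : ℂ) • a)) = 0 := by
  induction hf using Submodule.span_induction with
  | mem f hf =>
    obtain ⟨x, hx⟩ := hf
    rw [hx]
    simp only [Pi.sub_apply, trc_diagRep, linForm_smul]
    norm_num
  | zero => rfl
  | add f g _ _ hf hg => simp [-zero_smul, hf, hg]
  | smul c f _ hf => simp [-zero_smul, hf]

lemma le_analyticOrderAt_of_mem_Jideal_pow {n : ℕ} (a : Fin n → ℂ) (k : ℕ) {f : Xring n}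
    (hf : f ∈ Jideal n ^ k) :
    (k : ℕ∞) ≤ analyticOrderAt (fun t : ℂ => (f : FR n) (diagRep (t • a))) 0 := by
  have han : ∀ f : Xring n, AnalyticAt ℂ (fun t : ℂ => (f : FR n) (diagRep (t • a))) 0 :=
    fun f => (differentiable_Xring a f.2).analyticAt 0
  induction hf using Submodule.pow_induction_on_left' with
  | algebraMap r => simp
  | add f g k _ _ hf hg => exact (le_min hf hg).trans le_analyticOrderAt_add
  | mem_mul f hf k g _ hg =>
    have h1 : 1 ≤ analyticOrderAt (fun t : ℂ => (f : FR n) (diagRep (t • a))) 0 :=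
      Order.one_le_iff_ne_zero.2
        ((han f).analyticOrderAt_ne_zero.2 (Jideal_apply_zero hf a))
    have hmul := analyticOrderAt_mul (han f) (han g)
    calc ((k + 1 : ℕ) : ℕ∞) = 1 + k := by push_cast; exact add_comm _ _
      _ ≤ _ := add_le_add h1 hg
      _ = _ := hmul.symm

/-- **Theorem (Theorem 3.5 / Theorem 1.1(2))**: the intersection of all powers `J^k`, `k ≥ 1`,
of the ideal `J` is the zero ideal of `𝔛_ℚ(H)`. -/
theorem iInf_pow_Jideal_eq_bot (n : ℕ) (hn : 1 ≤ n) :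
    (⨅ k : ℕ, Jideal n ^ (k + 1)) = ⊥ := by
  refine eq_bot_iff.2 fun f hf => ?_
  rw [Submodule.mem_iInf] at hf
  refine Submodule.mem_bot _ |>.2 (Subtype.ext (funext fun ρ => ?_))
  obtain ⟨a, ha⟩ := exists_trc_eq ρ
  have hdiff := differentiable_Xring a f.2
  have htop : analyticOrderAt (fun t : ℂ => (f : FR n) (diagRep (t • a))) 0 = ⊤ :=
    ENat.eq_top_iff_forall_ge.2 fun k =>
      le_analyticOrderAt_of_mem_Jideal_pow a k (Ideal.pow_le_pow_right k.le_succ (hf k))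
  have hzero := AnalyticOnNhd.eq_of_eventuallyEq (f := fun t : ℂ => (f : FR n) (diagRep (t • a)))
    (g := 0) (fun t _ => hdiff.analyticAt t) (fun t _ => analyticAt_const)
    (analyticOrderAt_eq_top.1 htop)
  have h1 : (f : FR n) (diagRep ((1 : ℂ) • a)) = 0 := congrFun hzero 1
  rw [one_smul] at h1
  rw [Xring_apply_eq (fun x => (ha x).trans (trc_diagRep a x).symm) f.2, h1]
  rfl
end
end

section
/- The weight is additive on products: if f and g are nonzero elements of 𝔛_ℚ(H) with f ∈ J^{k₁} \ J^{k₁+1} and g ∈ J^{k₂} \ J^{k₂+1} (where J^0 := 𝔛_ℚ(H)), then fg ∈ J^{k₁+k₂} \ J^{k₁+k₂+1}. -/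
set_option synthInstance.maxHeartbeats 1000000
set_option maxHeartbeats 1000000

noncomputable section

/-- The Fricke character `tr x` as an element of `𝔛_ℚ(H)`. -/
def frickeChar {n : ℕ} (x : H n) : Xring n :=
  ⟨trc x, Algebra.subset_adjoin ⟨x, rfl⟩⟩

/-- The rational group ring of `H`. -/
abbrev GroupRing (n : ℕ) : Type := MonoidAlgebra ℚ (H n)

/-- The group element `x` in the group ring. -/
abbrev mono {n : ℕ} (x : H n) : GroupRing n := MonoidAlgebra.of ℚ (H n) x

theorem mono_mul {n : ℕ} (x y : H n) : mono (x * y) = mono x * mono y := map_mul _ x y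

theorem mono_one {n : ℕ} : mono (1 : H n) = 1 := map_one _

theorem trc_mul_trc {n : ℕ} (x y : H n) :
    trc x * trc y = trc (x * y) + trc (x * y⁻¹) := by
  funext ρ
  have hdet := (ρ y).det_coe
  simp only [trc, Pi.mul_apply, Pi.add_apply, map_mul, map_inv,
    Matrix.SpecialLinearGroup.coe_mul, Matrix.SpecialLinearGroup.coe_inv,
    Matrix.trace_fin_two, Matrix.mul_apply, Fin.sum_univ_two, Matrix.adjugate_fin_two]
  simp
  ring

theorem frickeChar_mul_frickeChar {n : ℕ} (x y : H n) :
    frickeChar x * frickeChar y = frickeChar (x * y) + frickeChar (x * y⁻¹) :=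
  Subtype.ext (trc_mul_trc x y)

theorem frickeChar_inv {n : ℕ} (x : H n) : frickeChar x⁻¹ = frickeChar x := by
  refine Subtype.ext (funext fun ρ => ?_)
  simp only [frickeChar, trc, map_inv, Matrix.SpecialLinearGroup.coe_inv,
    Matrix.trace_fin_two, Matrix.adjugate_fin_two]
  simp [add_comm]

theorem frickeChar_one {n : ℕ} : frickeChar (1 : H n) = 2 := by
  refine Subtype.ext (funext fun ρ => ?_)
  simp only [frickeChar, trc, map_one, Matrix.SpecialLinearGroup.coe_one, Matrix.trace_one,
    Fintype.card_fin]
  rfl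

theorem trc'_eq {n : ℕ} (x : H n) : trc' x = frickeChar x - 2 := rfl

theorem Jideal_eq_span {n : ℕ} : Jideal n = Ideal.span (Set.range (trc' (n := n))) := by
  unfold Jideal
  congr 1
  ext f
  simp only [Set.mem_ofPred_eq, Set.mem_range, Subtype.ext_iff, trc', eq_comm]

/-- The involution of the group ring induced by inversion in `H`. -/
def inversion (n : ℕ) : GroupRing n →ₐ[ℚ] GroupRing n :=
  MonoidAlgebra.mapDomainAlgHom ℚ ℚ (invMonoidHom : H n →* H n)

theorem inversion_mono {n : ℕ} (x : H n) : inversion n (mono x) = mono x⁻¹ := by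
  simp [inversion]

/-- The linear map sending `x` to `tr x / 2`. -/
def halfTrace (n : ℕ) : GroupRing n →ₗ[ℚ] Xring n :=
  (Finsupp.linearCombination ℚ fun x : H n => (2⁻¹ : ℚ) • frickeChar x) ∘ₗ
    (MonoidAlgebra.coeffLinearEquiv ℚ).toLinearMap

theorem halfTrace_mono {n : ℕ} (x : H n) :
    halfTrace n (mono x) = (2⁻¹ : ℚ) • frickeChar x := by
  simp [halfTrace]

theorem halfTrace_mul_add_inversion {n : ℕ} (a b : GroupRing n) :
    halfTrace n (a * (b + inversion n b)) = (2 : ℚ) • (halfTrace n a * halfTrace n b) := by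
  induction b using MonoidAlgebra.induction_on with
  | of y =>
    induction a using MonoidAlgebra.induction_on with
    | of x =>
      rw [inversion_mono, mul_add, ← mono_mul, ← mono_mul, map_add]
      simp only [halfTrace_mono, smul_mul_assoc, mul_smul_comm, frickeChar_mul_frickeChar,
        smul_add, smul_smul]
      norm_num
    | add a b ha hb => simp only [add_mul, map_add, ha, hb, smul_add]
    | smul r a ha => simp only [smul_mul_assoc, map_smul, ha, smul_comm r]
  | add b c hb hc =>
    have : a * (b + c + inversion n (b + c)) =
        a * (b + inversion n b) + a * (c + inversion n c) := by
      rw [map_add]; ring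
    rw [this, map_add, hb, hc, map_add, mul_add, smul_add]
  | smul r b hb =>
    rw [map_smul, ← smul_add, mul_smul_comm, map_smul, hb, map_smul, mul_smul_comm, smul_comm]

/-- The subalgebra of elements of the group ring fixed by inversion. -/
abbrev invariants (n : ℕ) : Subalgebra ℚ (GroupRing n) :=
  AlgHom.equalizer (inversion n) (AlgHom.id ℚ (GroupRing n))

theorem halfTrace_mul {n : ℕ} (a : GroupRing n) (b : invariants n) :
    halfTrace n (a * b) = halfTrace n a * halfTrace n (b : GroupRing n) := by
  have h := halfTrace_mul_add_inversion a (b : GroupRing n)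
  have hb : inversion n (b : GroupRing n) = b := b.2
  rw [hb, mul_add, map_add, two_smul ℚ, ← two_smul ℚ, ← two_smul ℚ] at h
  exact smul_right_injective _ (two_ne_zero' ℚ) h

/-- `halfTrace` restricted to the invariants, as an algebra homomorphism. -/
def invariantsToXring (n : ℕ) : invariants n →ₐ[ℚ] Xring n :=
  AlgHom.ofLinearMap (halfTrace n ∘ₗ (invariants n).val.toLinearMap)
    (by
      change halfTrace n 1 = 1
      rw [← mono_one, halfTrace_mono, frickeChar_one]
      refine Subtype.ext ?_
      funext ρ
      change (2⁻¹ : ℚ) • (2 : ℂ) = 1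
      simp [Algebra.smul_def])
    (fun a b => halfTrace_mul (a : GroupRing n) b)

theorem invariantsToXring_apply {n : ℕ} (a : invariants n) :
    invariantsToXring n a = halfTrace n (a : GroupRing n) := rfl

/-- The diagonal embedding of `ℂˣ` in `SL(2,ℂ)`. -/
def diagHom : ℂˣ →* SL2 where
  toFun u := ⟨!![(u : ℂ), 0; 0, ((u⁻¹ : ℂˣ) : ℂ)], by simp [Matrix.det_fin_two]⟩
  map_one' := by ext i j; fin_cases i <;> fin_cases j <;> simp
  map_mul' u v := by
    refine Subtype.ext ?_
    change !![((u * v : ℂˣ) : ℂ), 0; 0, (((u * v)⁻¹ : ℂˣ) : ℂ)] =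
      !![(u : ℂ), 0; 0, ((u⁻¹ : ℂˣ) : ℂ)] * !![(v : ℂ), 0; 0, ((v⁻¹ : ℂˣ) : ℂ)]
    rw [Matrix.mul_fin_two]
    simp [mul_comm]

theorem coe_diagHom (u : ℂˣ) :
    (diagHom u : Matrix (Fin 2) (Fin 2) ℂ) = !![(u : ℂ), 0; 0, ((u⁻¹ : ℂˣ) : ℂ)] := rfl

/-- Evaluation of the group ring at a character of `H`. -/
abbrev evalChar {n : ℕ} (χ : H n →* ℂˣ) : GroupRing n →ₐ[ℚ] ℂ :=
  MonoidAlgebra.lift ℚ ℂ (H n) ((Units.coeHom ℂ).comp χ)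

theorem halfTrace_apply_diag {n : ℕ} (χ : H n →* ℂˣ) (a : GroupRing n) :
    (halfTrace n a : FR n) (diagHom.comp χ) =
      (2⁻¹ : ℚ) • evalChar χ (a + inversion n a) := by
  induction a using MonoidAlgebra.induction_on with
  | of x =>
    rw [halfTrace_mono, inversion_mono, map_add, MonoidAlgebra.lift_of, MonoidAlgebra.lift_of]
    change (2⁻¹ : ℚ) • trc x (diagHom.comp χ) = _
    simp [trc, coe_diagHom, Matrix.trace_fin_two]
  | add a b ha hb =>
    rw [map_add, Subalgebra.coe_add, Pi.add_apply, ha, hb, ← smul_add, ← map_add,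
      map_add (inversion n), add_add_add_comm]
  | smul r a ha =>
    rw [map_smul, map_smul, ← smul_add, map_smul, smul_comm, ← ha]; rfl

theorem exists_char_ne {n : ℕ} {x y : H n} (h : x ≠ y) : ∃ χ : H n →* ℂˣ, χ x ≠ χ y := by
  obtain ⟨i, hi⟩ : ∃ i, x.toAdd i ≠ y.toAdd i := by
    by_contra! hc
    exact h (Multiplicative.toAdd.injective (funext hc))
  let χ : H n →* ℂˣ :=
    (zpowersHom ℂˣ (Units.mk0 2 two_ne_zero)).comp (Pi.evalAddMonoidHom _ i).toMultiplicative
  refine ⟨χ, fun hχ => hi ?_⟩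
  have h2 : ((2 : ℝ) ^ (x.toAdd i)) = 2 ^ (y.toAdd i) := by
    have := congrArg (fun u : ℂˣ => ‖(u : ℂ)‖) hχ
    simpa [χ, zpowersHom_apply] using this
  exact zpow_right_injective₀ (by norm_num) (by norm_num) h2

theorem eq_zero_of_evalChar {n : ℕ} (a : GroupRing n)
    (h : ∀ χ : H n →* ℂˣ, evalChar χ a = 0) : a = 0 := by
  let e : H n → ((H n →* ℂˣ) →* ℂ) := fun x =>
    (Units.coeHom ℂ).comp (MonoidHom.eval x)
  have he : Function.Injective e := by
    intro x y hxy
    by_contra hne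
    obtain ⟨χ, hχ⟩ := exists_char_ne hne
    exact hχ (Units.ext (DFunLike.congr_fun hxy χ))
  have hli : LinearIndependent ℚ fun x : H n => (e x : (H n →* ℂˣ) → ℂ) :=
    ((linearIndependent_monoidHom (H n →* ℂˣ) ℂ).comp e he).restrict_scalars' ℚ
  have h0 : Finsupp.linearCombination ℚ (fun x : H n => (e x : (H n →* ℂˣ) → ℂ)) a.coeff = 0 := by
    funext χ
    have := h χ
    rw [MonoidAlgebra.lift_apply] at this
    simpa [Finsupp.linearCombination_apply, Finsupp.sum, e] using this
  exact MonoidAlgebra.coeff_injective (linearIndependent_iff.mp hli _ h0)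

theorem invariantsToXring_injective (n : ℕ) : Function.Injective (invariantsToXring n) := by
  rw [injective_iff_map_eq_zero]
  intro a ha
  have hinv : inversion n (a : GroupRing n) = a := a.2
  refine Subtype.ext (eq_zero_of_evalChar _ fun χ => ?_)
  have := halfTrace_apply_diag χ (a : GroupRing n)
  rw [← invariantsToXring_apply, ha, hinv, ← two_smul ℚ, map_smul, smul_smul] at this
  simpa using this.symm

theorem halfTrace_add_inversion {n : ℕ} (x : H n) :
    halfTrace n (mono x + mono x⁻¹) = frickeChar x := by
  rw [map_add, halfTrace_mono, halfTrace_mono, frickeChar_inv, ← add_smul]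
  norm_num

/-- The invariant element `x + x⁻¹`. -/
def symmetrized {n : ℕ} (x : H n) : invariants n :=
  ⟨mono x + mono x⁻¹, by
    change inversion n _ = _
    rw [map_add, inversion_mono, inversion_mono, inv_inv, add_comm]; rfl⟩

theorem invariantsToXring_symmetrized {n : ℕ} (x : H n) :
    invariantsToXring n (symmetrized x) = frickeChar x :=
  halfTrace_add_inversion x

theorem invariantsToXring_surjective (n : ℕ) : Function.Surjective (invariantsToXring n) := by
  have hle : Xring n ≤ ((Xring n).val.comp (invariantsToXring n)).range :=
    Algebra.adjoin_le (by
      rintro _ ⟨x, rfl⟩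
      exact ⟨symmetrized x, congrArg Subtype.val (invariantsToXring_symmetrized x)⟩)
  intro f
  obtain ⟨a, ha⟩ := hle f.2
  exact ⟨a, Subtype.ext ha⟩

/-- The invariants of the group ring are the ring of Fricke characters. -/
def invariantsEquiv (n : ℕ) : invariants n ≃ₐ[ℚ] Xring n :=
  AlgEquiv.ofBijective (invariantsToXring n)
    ⟨invariantsToXring_injective n, invariantsToXring_surjective n⟩

/-- The embedding of the ring of Fricke characters in the group ring. -/
def toGroupRing (n : ℕ) : Xring n →ₐ[ℚ] GroupRing n :=
  (invariants n).val.comp (invariantsEquiv n).symm.toAlgHom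

theorem halfTrace_toGroupRing {n : ℕ} (f : Xring n) : halfTrace n (toGroupRing n f) = f :=
  (invariantsEquiv n).apply_symm_apply f

theorem halfTrace_mul_toGroupRing {n : ℕ} (a : GroupRing n) (f : Xring n) :
    halfTrace n (a * toGroupRing n f) = halfTrace n a * f := by
  conv_rhs => rw [← halfTrace_toGroupRing f]
  exact halfTrace_mul a ((invariantsEquiv n).symm f)

theorem toGroupRing_frickeChar {n : ℕ} (x : H n) :
    toGroupRing n (frickeChar x) = mono x + mono x⁻¹ := by
  have h : (invariantsEquiv n).symm (frickeChar x) = symmetrized x := by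
    rw [AlgEquiv.symm_apply_eq]
    exact (invariantsToXring_symmetrized x).symm
  exact congrArg Subtype.val h

theorem toGroupRing_trc' {n : ℕ} (x : H n) :
    toGroupRing n (trc' x) = mono x⁻¹ * ((mono x - 1) * (mono x - 1)) := by
  have h : mono x⁻¹ * mono x = 1 := by
    rw [← mono_mul, inv_mul_cancel, mono_one]
  rw [trc'_eq, map_sub, toGroupRing_frickeChar, map_ofNat]
  linear_combination (2 - mono x) * h

/-- The augmentation ideal of the group ring. -/
def augIdeal (n : ℕ) : Ideal (GroupRing n) :=
  Ideal.span (Set.range fun x : H n => mono x - 1)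

theorem mono_sub_one_mem {n : ℕ} (x : H n) : mono x - 1 ∈ augIdeal n :=
  Ideal.subset_span ⟨x, rfl⟩

theorem map_Jideal (n : ℕ) : (Jideal n).map (toGroupRing n) = augIdeal n ^ 2 := by
  apply le_antisymm
  · rw [Jideal_eq_span, Ideal.map_span, Ideal.span_le]
    rintro _ ⟨_, ⟨x, rfl⟩, rfl⟩
    rw [toGroupRing_trc', pow_two]
    exact Ideal.mul_mem_left _ _ (Ideal.mul_mem_mul (mono_sub_one_mem x) (mono_sub_one_mem x))
  · have hsq (x : H n) : (mono x - 1) ^ 2 ∈ (Jideal n).map (toGroupRing n) := by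
      have h : mono x * mono x⁻¹ = 1 := by
        rw [← mono_mul, mul_inv_cancel, mono_one]
      have : (mono x - 1) ^ 2 = mono x * toGroupRing n (trc' x) := by
        rw [toGroupRing_trc']
        linear_combination (-(mono x - 1) ^ 2) * h
      rw [this]
      refine Ideal.mul_mem_left _ _ (Ideal.mem_map_of_mem _ ?_)
      rw [Jideal_eq_span]
      exact Ideal.subset_span ⟨x, rfl⟩
    rw [pow_two, augIdeal, Ideal.span_mul_span', Ideal.span_le]
    rintro _ ⟨_, ⟨x, rfl⟩, _, ⟨y, rfl⟩, rfl⟩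
    change (mono x - 1) * (mono y - 1) ∈ (Jideal n).map (toGroupRing n)
    have h2 : (2 : GroupRing n) * ((mono x - 1) * (mono y - 1)) ∈
        (Jideal n).map (toGroupRing n) := by
      have hid : (2 : GroupRing n) * ((mono x - 1) * (mono y - 1)) =
          (mono (x * y) - 1) ^ 2 - mono y ^ 2 * (mono x - 1) ^ 2
            + (1 - 2 * mono x) * (mono y - 1) ^ 2 := by
        rw [mono_mul]; ring
      rw [hid]
      exact add_mem (sub_mem (hsq _) (Ideal.mul_mem_left _ _ (hsq _)))
        (Ideal.mul_mem_left _ _ (hsq _))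
    have hhalf : algebraMap ℚ (GroupRing n) 2⁻¹ * 2 = 1 := by
      rw [← map_ofNat (algebraMap ℚ (GroupRing n)) 2, ← map_mul,
        inv_mul_cancel₀ two_ne_zero, map_one]
    have := Ideal.mul_mem_left _ (algebraMap ℚ (GroupRing n) 2⁻¹) h2
    rwa [← mul_assoc, hhalf, one_mul] at this

theorem toGroupRing_mem_augIdeal_pow {n k : ℕ} {f : Xring n} (hf : f ∈ Jideal n ^ k) :
    toGroupRing n f ∈ augIdeal n ^ (2 * k) := by
  rw [pow_mul, ← map_Jideal, ← Ideal.map_pow]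
  exact Ideal.mem_map_of_mem _ hf

theorem halfTrace_mem_Jideal {n : ℕ} {a : GroupRing n} (ha : a ∈ augIdeal n) :
    halfTrace n a ∈ Jideal n := by
  have hgen (x : H n) : halfTrace n (mono x - 1) ∈ Jideal n := by
    have : halfTrace n (mono x - 1) = (2⁻¹ : ℚ) • trc' x := by
      rw [trc'_eq, smul_sub, ← frickeChar_one, ← halfTrace_mono, ← halfTrace_mono, mono_one,
        map_sub]
    rw [this, Jideal_eq_span]
    exact Submodule.smul_of_tower_mem _ _ (Ideal.subset_span ⟨x, rfl⟩)
  have hmul (x : H n) (c : GroupRing n) : halfTrace n (c * (mono x - 1)) ∈ Jideal n := by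
    induction c using MonoidAlgebra.induction_on with
    | of y =>
      have : mono y * (mono x - 1) = (mono (y * x) - 1) - (mono y - 1) := by
        rw [mono_mul]; ring
      rw [this, map_sub]
      exact sub_mem (hgen _) (hgen _)
    | add a b ha hb => rw [add_mul, map_add]; exact add_mem ha hb
    | smul r a ha =>
      rw [smul_mul_assoc, map_smul]
      exact Submodule.smul_of_tower_mem _ _ ha
  induction ha using Submodule.span_induction with
  | mem a ha => obtain ⟨x, rfl⟩ := ha; exact hgen x
  | zero => rw [map_zero]; exact zero_mem _
  | add a b _ _ ha hb => rw [map_add]; exact add_mem ha hb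
  | smul c a ha _ =>
    clear * - ha hmul
    induction ha using Submodule.span_induction generalizing c with
    | mem a ha => obtain ⟨x, rfl⟩ := ha; exact hmul x c
    | zero => rw [smul_zero, map_zero]; exact zero_mem _
    | add a b _ _ ha hb => rw [smul_add, map_add]; exact add_mem (ha c) (hb c)
    | smul d a _ ha => rw [smul_smul]; exact ha _

theorem halfTrace_mem_Jideal_pow_succ {n k : ℕ} {a : GroupRing n}
    (ha : a ∈ augIdeal n ^ (2 * k + 1)) : halfTrace n a ∈ Jideal n ^ (k + 1) := by
  rw [pow_succ', pow_mul, ← map_Jideal, ← Ideal.map_pow] at ha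
  induction ha using Submodule.mul_induction_on' with
  | mem_mul_mem a ha b hb =>
    induction hb using Submodule.span_induction generalizing a with
    | mem b hb =>
      obtain ⟨f, hf, rfl⟩ := hb
      change halfTrace n (a * toGroupRing n f) ∈ _
      rw [halfTrace_mul_toGroupRing, pow_succ']
      exact Ideal.mul_mem_mul (halfTrace_mem_Jideal ha) hf
    | zero => rw [mul_zero, map_zero]; exact zero_mem _
    | add b c _ _ hb hc => rw [mul_add, map_add]; exact add_mem (hb a ha) (hc a ha)
    | smul c b _ hb =>
      rw [smul_eq_mul, ← mul_assoc]
      exact hb _ (Ideal.mul_mem_right _ _ ha)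
  | add a _ b _ ha hb => rw [map_add]; exact add_mem ha hb

theorem mem_Jideal_pow_succ {n k : ℕ} {f : Xring n}
    (hf : toGroupRing n f ∈ augIdeal n ^ (2 * k + 1)) : f ∈ Jideal n ^ (k + 1) := by
  rw [← halfTrace_toGroupRing f]
  exact halfTrace_mem_Jideal_pow_succ hf

/-- The power series `1 + X_i` as a unit. -/
def onePlusX {n : ℕ} (i : Fin n) : (MvPowerSeries (Fin n) ℚ)ˣ :=
  (MvPowerSeries.isUnit_iff_constantCoeff (φ := 1 + MvPowerSeries.X i) |>.mpr (by simp)).unit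

/-- The homomorphism from `H` to the units of the power series ring sending `x_i` to `1 + X_i`. -/
def magnusHom (n : ℕ) : H n →* (MvPowerSeries (Fin n) ℚ)ˣ where
  toFun x := ∏ i, onePlusX i ^ (x.toAdd i)
  map_one' := by simp
  map_mul' x y := by simp [zpow_add, Finset.prod_mul_distrib]

/-- The expansion of the group ring at the trivial representation. -/
def magnus (n : ℕ) : GroupRing n →ₐ[ℚ] MvPowerSeries (Fin n) ℚ :=
  MonoidAlgebra.lift ℚ _ (H n) ((Units.coeHom _).comp (magnusHom n))

theorem magnus_mono {n : ℕ} (x : H n) : magnus n (mono x) = magnusHom n x := by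
  rw [magnus, MonoidAlgebra.lift_of]; rfl

theorem magnusHom_xgen {n : ℕ} (i : Fin n) :
    (magnusHom n (xgen n i) : MvPowerSeries (Fin n) ℚ) = 1 + MvPowerSeries.X i := by
  have : magnusHom n (xgen n i) = onePlusX i := by
    change ∏ j, onePlusX j ^ ((Pi.single i 1 : Fin n → ℤ) j) = _
    rw [Finset.prod_eq_single i]
    · simp
    · intro j _ hj; simp [Pi.single_eq_of_ne hj]
    · simp
  rw [this]; rfl

theorem constantCoeff_magnusHom {n : ℕ} (x : H n) :
    MvPowerSeries.constantCoeff (magnusHom n x : MvPowerSeries (Fin n) ℚ) = 1 := by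
  have h (i : Fin n) : Units.map (MvPowerSeries.constantCoeff (σ := Fin n) (R := ℚ)).toMonoidHom
      (onePlusX i) = 1 := by
    ext
    change MvPowerSeries.constantCoeff (1 + MvPowerSeries.X i : MvPowerSeries (Fin n) ℚ) = 1
    simp
  have h2 : Units.map (MvPowerSeries.constantCoeff (σ := Fin n) (R := ℚ)).toMonoidHom
      (magnusHom n x) = 1 := by
    change Units.map _ (∏ i, onePlusX i ^ (x.toAdd i)) = 1
    simp only [map_prod, map_zpow, h, one_zpow, Finset.prod_const_one]
  exact congrArg Units.val h2

theorem constantCoeff_magnus {n : ℕ} {a : GroupRing n} (ha : a ∈ augIdeal n) :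
    MvPowerSeries.constantCoeff (magnus n a) = 0 := by
  have hle : augIdeal n ≤
      RingHom.ker ((MvPowerSeries.constantCoeff (σ := Fin n) (R := ℚ)).comp
        (magnus n).toRingHom) := by
    rw [augIdeal, Ideal.span_le]
    rintro _ ⟨x, rfl⟩
    change MvPowerSeries.constantCoeff (magnus n (mono x - 1)) = 0
    rw [map_sub, magnus_mono, map_one, map_sub, constantCoeff_magnusHom, map_one, sub_self]
  exact hle ha

theorem le_order_magnus {n m : ℕ} {a : GroupRing n} (ha : a ∈ augIdeal n ^ m) :
    (m : ℕ∞) ≤ (magnus n a).order := by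
  induction m generalizing a with
  | zero => simp
  | succ m ih =>
    rw [pow_succ'] at ha
    induction ha using Submodule.mul_induction_on' with
    | mem_mul_mem a ha b hb =>
      rw [map_mul, MvPowerSeries.order_mul, Nat.cast_succ, add_comm]
      exact add_le_add (MvPowerSeries.one_le_order_iff_constCoeff_eq_zero.mpr
        (constantCoeff_magnus ha)) (ih hb)
    | add a _ b _ ha hb =>
      rw [map_add]
      exact (le_min ha hb).trans MvPowerSeries.min_order_le_add

/-- The embedding of the polynomial ring in the group ring sending `X_i` to `x_i - 1`. -/
def polyToGroupRing (n : ℕ) : MvPolynomial (Fin n) ℚ →ₐ[ℚ] GroupRing n :=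
  MvPolynomial.aeval fun i => mono (xgen n i) - 1

theorem magnus_polyToGroupRing {n : ℕ} (p : MvPolynomial (Fin n) ℚ) :
    magnus n (polyToGroupRing n p) = p := by
  have : (magnus n).comp (polyToGroupRing n) = MvPolynomial.coeToMvPowerSeries.algHom ℚ := by
    apply MvPolynomial.algHom_ext
    intro i
    simp only [AlgHom.comp_apply, polyToGroupRing, MvPolynomial.aeval_X, map_sub, map_one,
      magnus_mono, magnusHom_xgen]
    simp
  simpa using DFunLike.congr_fun this p

theorem mono_natCast_mem_range {n : ℕ} (v : Fin n → ℕ) :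
    mono (Multiplicative.ofAdd fun i => (v i : ℤ)) ∈ (polyToGroupRing n).range := by
  have hgen (i : Fin n) : mono (xgen n i) ∈ (polyToGroupRing n).range :=
    ⟨1 + MvPolynomial.X i, by simp [polyToGroupRing]⟩
  have : (Multiplicative.ofAdd fun i => (v i : ℤ) : H n) = ∏ i, xgen n i ^ v i := by
    apply Multiplicative.toAdd.injective
    funext j
    simp [xgen, toAdd_prod, Pi.single_apply]
  rw [this, mono, map_prod]
  exact prod_mem fun i _ => by rw [map_pow]; exact pow_mem (hgen i) _

theorem exists_mono_mul_mem_range {n : ℕ} (a : GroupRing n) :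
    ∃ w : H n, mono w ∈ (polyToGroupRing n).range ∧ mono w * a ∈ (polyToGroupRing n).range := by
  induction a using MonoidAlgebra.induction_on with
  | of x =>
    refine ⟨Multiplicative.ofAdd fun i => ((-x.toAdd i).toNat : ℤ),
      mono_natCast_mem_range _, ?_⟩
    have : (Multiplicative.ofAdd fun i => ((-x.toAdd i).toNat : ℤ) : H n) * x =
        Multiplicative.ofAdd fun i => ((x.toAdd i).toNat : ℤ) := by
      apply Multiplicative.toAdd.injective
      funext j
      simp only [toAdd_mul, toAdd_ofAdd, Pi.add_apply]
      omega
    rw [← mono_mul, this]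
    exact mono_natCast_mem_range _
  | add a b ha hb =>
    obtain ⟨v, hv, hva⟩ := ha
    obtain ⟨w, hw, hwb⟩ := hb
    refine ⟨v * w, by rw [mono_mul]; exact mul_mem hv hw, ?_⟩
    have : mono (v * w) * (a + b) = mono w * (mono v * a) + mono v * (mono w * b) := by
      rw [mono_mul]; ring
    rw [this]
    exact add_mem (mul_mem hw hva) (mul_mem hv hwb)
  | smul r a ha =>
    obtain ⟨w, hw, hwa⟩ := ha
    exact ⟨w, hw, by rw [mul_smul_comm]; exact Subalgebra.smul_mem _ hwa r⟩

theorem mem_augIdeal_pow_of_le_order {n m : ℕ} {a : GroupRing n}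
    (h : (m : ℕ∞) ≤ (magnus n a).order) : a ∈ augIdeal n ^ m := by
  obtain ⟨w, -, p, hp⟩ := exists_mono_mul_mem_range a
  have hp' : polyToGroupRing n p = mono w * a := hp
  have hord : (m : ℕ∞) ≤ (p : MvPowerSeries (Fin n) ℚ).order := by
    rw [← magnus_polyToGroupRing, hp', map_mul, MvPowerSeries.order_mul]
    exact le_add_left h
  have hpm : p ∈ MvPolynomial.idealOfVars (Fin n) ℚ ^ m := by
    rw [MvPolynomial.mem_pow_idealOfVars_iff']
    intro d hd
    rw [← MvPolynomial.coeff_coe]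
    exact MvPowerSeries.coeff_of_lt_order (lt_of_lt_of_le (by exact_mod_cast hd) hord)
  have hmap : (MvPolynomial.idealOfVars (Fin n) ℚ).map (polyToGroupRing n) ≤ augIdeal n := by
    rw [MvPolynomial.idealOfVars, Ideal.map_span, Ideal.span_le]
    rintro _ ⟨_, ⟨i, rfl⟩, rfl⟩
    simpa [polyToGroupRing] using mono_sub_one_mem (xgen n i)
  have hwa : mono w * a ∈ augIdeal n ^ m := by
    rw [← hp']
    refine Ideal.pow_right_mono hmap m ?_
    rw [← Ideal.map_pow]
    exact Ideal.mem_map_of_mem _ hpm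
  have : a = mono w⁻¹ * (mono w * a) := by
    rw [← mul_assoc, ← mono_mul, inv_mul_cancel, mono_one, one_mul]
  rw [this]
  exact Ideal.mul_mem_left _ _ hwa

theorem mul_notMem_augIdeal_pow {n k l : ℕ} {a b : GroupRing n}
    (ha : a ∉ augIdeal n ^ (k + 1)) (hb : b ∉ augIdeal n ^ (l + 1)) :
    a * b ∉ augIdeal n ^ (k + l + 1) := by
  intro hab
  have h := le_order_magnus hab
  rw [map_mul, MvPowerSeries.order_mul] at h
  have ha' := lt_of_not_ge (mt mem_augIdeal_pow_of_le_order ha)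
  have hb' := lt_of_not_ge (mt mem_augIdeal_pow_of_le_order hb)
  generalize (magnus n a).order = s at *
  generalize (magnus n b).order = t at *
  lift s to ℕ using ha'.ne_top
  lift t to ℕ using hb'.ne_top
  norm_cast at *
  omega

/-- **Proposition 4.1 (additivity of the weight)**: if `f ∈ J^{k₁} \ J^{k₁+1}` and
`g ∈ J^{k₂} \ J^{k₂+1}` are nonzero elements of `𝔛_ℚ(H)` (with `J^0 = 𝔛_ℚ(H)` the unit ideal),
then `f·g ∈ J^{k₁+k₂} \ J^{k₁+k₂+1}`. -/
theorem weight_add (n : ℕ) (hn : 1 ≤ n) (f g : Xring n) (hf0 : f ≠ 0) (hg0 : g ≠ 0)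
    (k₁ k₂ : ℕ) (hf : f ∈ Jideal n ^ k₁) (hf' : f ∉ Jideal n ^ (k₁ + 1))
    (hg : g ∈ Jideal n ^ k₂) (hg' : g ∉ Jideal n ^ (k₂ + 1)) :
    f * g ∈ Jideal n ^ (k₁ + k₂) ∧ f * g ∉ Jideal n ^ (k₁ + k₂ + 1) := by
  refine ⟨pow_add (Jideal n) k₁ k₂ ▸ Ideal.mul_mem_mul hf hg, fun hfg => ?_⟩
  have hle : 2 * k₁ + 2 * k₂ + 1 ≤ 2 * (k₁ + k₂ + 1) := by omega
  refine mul_notMem_augIdeal_pow (mt mem_Jideal_pow_succ hf') (mt mem_Jideal_pow_succ hg') ?_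
  rw [← map_mul]
  exact Ideal.pow_le_pow_right hle (toGroupRing_mem_augIdeal_pow hfg)
end
end

section
/- For every x ∈ H and every integer α, the element tr'(x^α) − α²·tr'(x) lies in J². -/
set_option synthInstance.maxHeartbeats 1000000
set_option maxHeartbeats 1000000

noncomputable section

lemma trc_mul_add_trc_mul_inv {n : ℕ} (x y : H n) :
    trc (x * y) + trc (x * y⁻¹) = trc x * trc y := by
  funext ρ
  simp only [trc, Pi.add_apply, Pi.mul_apply, map_mul, map_inv, Matrix.SpecialLinearGroup.coe_mul,
    Matrix.SpecialLinearGroup.coe_inv, Matrix.adjugate_fin_two, Matrix.trace_fin_two,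
    Matrix.mul_apply, Fin.sum_univ_two, Matrix.of_apply, Matrix.cons_val', Matrix.cons_val_zero,
    Matrix.cons_val_one, Matrix.cons_val_fin_one]
  ring

lemma trc'_mul_add_trc'_mul_inv {n : ℕ} (x y : H n) :
    trc' (x * y) + trc' (x * y⁻¹) = trc' x * trc' y + 2 * trc' x + 2 * trc' y := by
  apply Subtype.ext
  change (trc (x * y) - 2) + (trc (x * y⁻¹) - 2)
    = (trc x - 2) * (trc y - 2) + 2 * (trc x - 2) + 2 * (trc y - 2)
  linear_combination trc_mul_add_trc_mul_inv x y

lemma trc'_one (n : ℕ) : trc' (1 : H n) = 0 := by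
  apply Subtype.ext
  funext ρ
  change trc (1 : H n) ρ - 2 = 0
  simp [trc]

lemma trc'_inv {n : ℕ} (x : H n) : trc' x⁻¹ = trc' x := by
  have h := trc'_mul_add_trc'_mul_inv 1 x
  rw [one_mul, one_mul, trc'_one] at h
  linear_combination h

lemma trc'_mem_Jideal {n : ℕ} (x : H n) : trc' x ∈ Jideal n :=
  Ideal.subset_span ⟨x, rfl⟩

lemma trc'_pow_sub_sq_mul_mem {n : ℕ} (x : H n) (k : ℕ) :
    trc' (x ^ k) - (k : Xring n) ^ 2 * trc' x ∈ Jideal n ^ 2 := by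
  induction k using Nat.twoStepInduction with
  | zero => simp [trc'_one]
  | one => simp
  | more k h₀ h₁ =>
    have h := trc'_mul_add_trc'_mul_inv (x ^ (k + 1)) x
    rw [← pow_succ, pow_succ x k, mul_inv_cancel_right, ← pow_succ] at h
    have hmul : trc' (x ^ (k + 1)) * trc' x ∈ Jideal n ^ 2 := by
      rw [sq]
      exact Ideal.mul_mem_mul (trc'_mem_Jideal _) (trc'_mem_Jideal _)
    convert add_mem (sub_mem (Ideal.mul_mem_left _ 2 h₁) h₀) hmul using 1
    push_cast
    linear_combination h

/-- **Lemma 3.1 (Lemma `candy`)**: for every `x ∈ H` and every integer `α`,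
`tr'(x^α) ≡ α² · tr'(x) (mod J²)`. -/
theorem trc'_zpow_sub_sq_smul_mem (n : ℕ) (hn : 1 ≤ n) (x : H n) (α : ℤ) :
    trc' (x ^ α) - ((α : ℚ) ^ 2) • trc' x ∈ Jideal n ^ 2 := by
  have smul_eq : ((α : ℚ) ^ 2) • trc' x = (α : Xring n) ^ 2 * trc' x := by
    simp [Algebra.smul_def]
  rw [smul_eq]
  obtain ⟨k, rfl | rfl⟩ := α.eq_nat_or_neg
  · simpa using trc'_pow_sub_sq_mul_mem x k
  · have cast_sq : ((-(k : ℤ) : ℤ) : Xring n) ^ 2 = (k : Xring n) ^ 2 := by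
      push_cast
      ring
    rw [cast_sq, zpow_neg, zpow_natCast, trc'_inv]
    exact trc'_pow_sub_sq_mul_mem x k
end
end
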